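/- For every finite projective plane Π of order q, the number of ordered 5-arcs of Π is C_5(Π) = (q^2 + q + 1)(q^2 + q)q^2(q - 1)^2(q^2 - 5q + 6). -/

import Mathlib

open scoped Classical

structure ProjPlane (q : ℕ) where
  Point : Type
  fintypePoint : Fintype Point
  L : Set (Set Point)
  unique_line : ∀ p₁ p₂ : Point, p₁ ≠ p₂ → ∃! ℓ, ℓ ∈ L ∧ p₁ ∈ ℓ ∧ p₂ ∈ ℓ
  unique_point : ∀ ℓ₁ ℓ₂, ℓ₁ ∈ L → ℓ₂ ∈ L → ℓ₁ ≠ ℓ₂ → ∃! p, p ∈ ℓ₁ ∧ p ∈ ℓ₂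
  nondegenerate : ∃ a b c d : Point, a ≠ b ∧ a ≠ c ∧ a ≠ d ∧ b ≠ c ∧ b ≠ d ∧ c ≠ d ∧
    ∀ ℓ ∈ L, ¬({a, b, c} ⊆ ℓ) ∧ ¬({a, b, d} ⊆ ℓ) ∧ ¬({a, c, d} ⊆ ℓ) ∧ ¬({b, c, d} ⊆ ℓ)
  line_card : ∀ ℓ ∈ L, ℓ.ncard = q + 1
  point_card : ∀ p : Point, {ℓ ∈ L | p ∈ ℓ}.ncard = q + 1

/-- A set of points is collinear if it is contained in a line. -/
noncomputable def ProjPlane.Collinear {q : ℕ} (Pl : ProjPlane q) (s : Set Pl.Point) : Prop :=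
  ∃ ℓ ∈ Pl.L, s ⊆ ℓ

/-- The number of ordered `n`-arcs of the plane. -/
noncomputable def ProjPlane.nArcs {q : ℕ} (Pl : ProjPlane q) (n : ℕ) : ℕ :=
  Nat.card {p : Fin n → Pl.Point // Function.Injective p ∧
    ∀ i j k : Fin n, i ≠ j → i ≠ k → j ≠ k → ¬ Pl.Collinear {p i, p j, p k}}

/-- Number of ordered strong realizations of the Fano plane. -/
noncomputable def ProjPlane.A7 {q : ℕ} (Pl : ProjPlane q) : ℕ :=
  Nat.card {p : ZMod 7 → Pl.Point // Function.Injective p ∧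
    ∃ σ : Equiv.Perm (ZMod 7), ∀ i j k : ZMod 7, i ≠ j → i ≠ k → j ≠ k →
      (Pl.Collinear {p (σ i), p (σ j), p (σ k)} ↔
        ∃ a : ZMod 7, ({i, j, k} : Set (ZMod 7)) = {a, a + 1, a + 3})}

/-- Number of ordered strong realizations of the Möbius–Kantor configuration. -/
noncomputable def ProjPlane.A8 {q : ℕ} (Pl : ProjPlane q) : ℕ :=
  Nat.card {p : ZMod 8 → Pl.Point // Function.Injective p ∧
    ∃ σ : Equiv.Perm (ZMod 8), ∀ i j k : ZMod 8, i ≠ j → i ≠ k → j ≠ k →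
      (Pl.Collinear {p (σ i), p (σ j), p (σ k)} ↔
        ∃ a : ZMod 8, ({i, j, k} : Set (ZMod 8)) = {a, a + 1, a + 3})}

namespace ProjPlane

variable {q : ℕ} (Pl : ProjPlane q)

theorem collinear_triple {a b c : Pl.Point} :
    Pl.Collinear {a, b, c} ↔ ∃ ℓ ∈ Pl.L, a ∈ ℓ ∧ b ∈ ℓ ∧ c ∈ ℓ := by
  simp [Collinear, Set.insert_subset_iff]

theorem exists_line_mem (a : Pl.Point) : ∃ ℓ ∈ Pl.L, a ∈ ℓ := by
  have h : {ℓ ∈ Pl.L | a ∈ ℓ}.ncard ≠ 0 := by simp [Pl.point_card a]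
  exact Set.nonempty_of_ncard_ne_zero h

/-- Any two points, distinct or not, lie on a common line. -/
theorem exists_line_mem_mem (a b : Pl.Point) : ∃ ℓ ∈ Pl.L, a ∈ ℓ ∧ b ∈ ℓ := by
  by_cases h : a = b
  · subst h
    simpa using Pl.exists_line_mem a
  · exact (Pl.unique_line a b h).exists

theorem line_eq {a b : Pl.Point} (hab : a ≠ b) {ℓ m : Set Pl.Point} (hℓ : ℓ ∈ Pl.L)
    (hm : m ∈ Pl.L) (haℓ : a ∈ ℓ) (hbℓ : b ∈ ℓ) (ham : a ∈ m) (hbm : b ∈ m) : ℓ = m :=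
  (Pl.unique_line a b hab).unique ⟨hℓ, haℓ, hbℓ⟩ ⟨hm, ham, hbm⟩

theorem collinear_iff_mem {a b x : Pl.Point} (hab : a ≠ b) {ℓ : Set Pl.Point} (hℓ : ℓ ∈ Pl.L)
    (ha : a ∈ ℓ) (hb : b ∈ ℓ) : Pl.Collinear {a, b, x} ↔ x ∈ ℓ := by
  rw [collinear_triple]
  refine ⟨fun ⟨m, hm, ham, hbm, hx⟩ => ?_, fun hx => ⟨ℓ, hℓ, ha, hb, hx⟩⟩
  rwa [Pl.line_eq hab hℓ hm ha hb ham hbm]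

theorem collinear_self_left (a b : Pl.Point) : Pl.Collinear {a, a, b} := by
  rw [collinear_triple]
  simpa using Pl.exists_line_mem_mem a b

theorem collinear_rotate {a b c : Pl.Point} (h : Pl.Collinear {a, b, c}) :
    Pl.Collinear {b, c, a} := by
  rw [collinear_triple] at h ⊢
  obtain ⟨ℓ, hℓ, ha, hb, hc⟩ := h
  exact ⟨ℓ, hℓ, hb, hc, ha⟩

theorem collinear_swap {a b c : Pl.Point} (h : Pl.Collinear {a, b, c}) :
    Pl.Collinear {b, a, c} := by
  rw [collinear_triple] at h ⊢
  obtain ⟨ℓ, hℓ, ha, hb, hc⟩ := h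
  exact ⟨ℓ, hℓ, hb, ha, hc⟩

theorem ne_of_not_collinear {a b c : Pl.Point} (h : ¬ Pl.Collinear {a, b, c}) :
    a ≠ b ∧ a ≠ c ∧ b ≠ c := by
  refine ⟨?_, ?_, ?_⟩ <;> rintro rfl <;> apply h
  · exact Pl.collinear_self_left _ _
  · exact Pl.collinear_rotate (Pl.collinear_self_left _ _)
  · exact Pl.collinear_rotate (Pl.collinear_rotate (Pl.collinear_self_left _ _))

instance : Fintype Pl.Point := Pl.fintypePoint

theorem sum_mem_line {ℓ : Set Pl.Point} (hℓ : ℓ ∈ Pl.L) :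
    ∑ x, (if x ∈ ℓ then 1 else 0 : ℤ) = q + 1 := by
  rw [Finset.sum_boole]
  have h := Pl.line_card ℓ hℓ
  rw [Set.ncard_eq_toFinset_card'] at h
  have : ({x | x ∈ ℓ} : Finset Pl.Point) = ℓ.toFinset := by ext; simp
  rw [this, h]
  push_cast
  rfl

theorem card_point : (Fintype.card Pl.Point : ℤ) = (q : ℤ) ^ 2 + q + 1 := by
  obtain ⟨p, -⟩ := Pl.nondegenerate
  let S : Finset (Set Pl.Point) := {ℓ | ℓ ∈ Pl.L ∧ p ∈ ℓ}
  have hS : S.card = q + 1 := by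
    have h := Pl.point_card p
    rw [Set.ncard_eq_toFinset_card'] at h
    rw [← h]
    congr 1
    ext; simp [S]
  have key : ∀ x : Pl.Point,
      (∑ ℓ ∈ S, (if x ∈ ℓ then 1 else 0 : ℤ)) = 1 + if x = p then (q : ℤ) else 0 := by
    intro x
    by_cases hx : x = p
    · subst hx
      rw [Finset.sum_congr rfl (g := fun _ => (1 : ℤ))
        (fun ℓ hℓ => by simp [(Finset.mem_filter.1 hℓ).2.2])]
      simp [hS, add_comm]
    · obtain ⟨m, hm, hpm, hxm⟩ := Pl.exists_line_mem_mem p x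
      rw [Finset.sum_eq_single m]
      · simp [hx, hxm]
      · intro ℓ hℓ hne
        have hℓ' := (Finset.mem_filter.1 hℓ).2
        rw [if_neg]
        exact fun hxℓ => hne (Pl.line_eq (Ne.symm hx) hℓ'.1 hm hℓ'.2 hxℓ hpm hxm)
      · intro h
        exact absurd (by simp [S, hm, hpm]) h
  have h := Finset.sum_comm (s := (Finset.univ : Finset Pl.Point)) (t := S)
    (f := fun x ℓ => (if x ∈ ℓ then 1 else 0 : ℤ))
  rw [Finset.sum_congr rfl (fun x _ => key x), Finset.sum_add_distrib,
    Finset.sum_congr (s₁ := S) rfl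
      (fun ℓ hℓ => Pl.sum_mem_line (Finset.mem_filter.1 hℓ).2.1)] at h
  simp [hS] at h
  linarith

theorem sum_ne (a : Pl.Point) :
    ∑ x, (if a ≠ x then 1 else 0 : ℤ) = (q : ℤ) ^ 2 + q := by
  have h : ∀ x, (if a ≠ x then 1 else 0 : ℤ) = 1 - if a = x then 1 else 0 := by
    intro x; split_ifs <;> simp_all
  simp only [h, Finset.sum_sub_distrib]
  simp [Pl.card_point]

theorem sum_not_collinear {a b : Pl.Point} (hab : a ≠ b) :
    ∑ x, (if ¬ Pl.Collinear {a, b, x} then 1 else 0 : ℤ) = (q : ℤ) ^ 2 := by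
  obtain ⟨ℓ, hℓ, ha, hb⟩ := Pl.exists_line_mem_mem a b
  have h : ∀ x, (if ¬ Pl.Collinear {a, b, x} then 1 else 0 : ℤ) = 1 - if x ∈ ℓ then 1 else 0 := by
    intro x
    rw [Pl.collinear_iff_mem hab hℓ ha hb]
    split_ifs <;> simp_all
  simp only [h, Finset.sum_sub_distrib, Pl.sum_mem_line hℓ]
  simp [Pl.card_point]

theorem sum_extend_three_arc {a b c : Pl.Point} (habc : ¬ Pl.Collinear {a, b, c}) :
    ∑ x, (if ¬ Pl.Collinear {a, b, x} ∧ ¬ Pl.Collinear {a, c, x} ∧ ¬ Pl.Collinear {b, c, x}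
      then 1 else 0 : ℤ) = ((q : ℤ) - 1) ^ 2 := by
  obtain ⟨hab, hac, hbc⟩ := Pl.ne_of_not_collinear habc
  obtain ⟨ℓ, hℓ, haℓ, hbℓ⟩ := Pl.exists_line_mem_mem a b
  obtain ⟨m, hm, ham, hcm⟩ := Pl.exists_line_mem_mem a c
  obtain ⟨n, hn, hbn, hcn⟩ := Pl.exists_line_mem_mem b c
  rw [Pl.collinear_iff_mem hab hℓ haℓ hbℓ] at habc
  have h : ∀ x, (if ¬ Pl.Collinear {a, b, x} ∧ ¬ Pl.Collinear {a, c, x} ∧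
      ¬ Pl.Collinear {b, c, x} then 1 else 0 : ℤ) =
      1 - (if x ∈ ℓ then 1 else 0) - (if x ∈ m then 1 else 0) - (if x ∈ n then 1 else 0) +
      (if x = a then 1 else 0) + (if x = b then 1 else 0) + (if x = c then 1 else 0) := by
    intro x
    rw [Pl.collinear_iff_mem hab hℓ haℓ hbℓ, Pl.collinear_iff_mem hac hm ham hcm,
      Pl.collinear_iff_mem hbc hn hbn hcn]
    have e := @Pl.line_eq
    grind
  simp only [h, Finset.sum_sub_distrib, Finset.sum_add_distrib, Pl.sum_mem_line hℓ,
    Pl.sum_mem_line hm, Pl.sum_mem_line hn]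
  simp [Pl.card_point]
  ring

theorem sum_mem_inter {ℓ m : Set Pl.Point} (hℓ : ℓ ∈ Pl.L) (hm : m ∈ Pl.L) (hne : ℓ ≠ m) :
    ∑ x, (if x ∈ ℓ ∧ x ∈ m then 1 else 0 : ℤ) = 1 := by
  obtain ⟨p, hp, hu⟩ := Pl.unique_point ℓ m hℓ hm hne
  have h : ∀ x, x ∈ ℓ ∧ x ∈ m ↔ x = p := fun x => ⟨hu x, fun h => h ▸ hp⟩
  simp [h]

theorem sum_extend_four_arc {a b c d : Pl.Point} (habc : ¬ Pl.Collinear {a, b, c})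
    (habd : ¬ Pl.Collinear {a, b, d}) (hacd : ¬ Pl.Collinear {a, c, d})
    (hbcd : ¬ Pl.Collinear {b, c, d}) :
    ∑ x, (if ¬ Pl.Collinear {a, b, x} ∧ ¬ Pl.Collinear {a, c, x} ∧ ¬ Pl.Collinear {a, d, x} ∧
      ¬ Pl.Collinear {b, c, x} ∧ ¬ Pl.Collinear {b, d, x} ∧ ¬ Pl.Collinear {c, d, x}
      then 1 else 0 : ℤ) = (q : ℤ) ^ 2 - 5 * q + 6 := by
  obtain ⟨hab, hac, hbc⟩ := Pl.ne_of_not_collinear habc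
  obtain ⟨-, had, hbd⟩ := Pl.ne_of_not_collinear habd
  obtain ⟨-, -, hcd⟩ := Pl.ne_of_not_collinear hacd
  obtain ⟨ℓab, h1, a1, b1⟩ := Pl.exists_line_mem_mem a b
  obtain ⟨ℓac, h2, a2, c2⟩ := Pl.exists_line_mem_mem a c
  obtain ⟨ℓad, h3, a3, d3⟩ := Pl.exists_line_mem_mem a d
  obtain ⟨ℓbc, h4, b4, c4⟩ := Pl.exists_line_mem_mem b c
  obtain ⟨ℓbd, h5, b5, d5⟩ := Pl.exists_line_mem_mem b d
  obtain ⟨ℓcd, h6, c6, d6⟩ := Pl.exists_line_mem_mem c d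
  rw [Pl.collinear_iff_mem hab h1 a1 b1] at habc habd
  rw [Pl.collinear_iff_mem hac h2 a2 c2] at hacd
  rw [Pl.collinear_iff_mem hbc h4 b4 c4] at hbcd
  have e := @Pl.line_eq
  have c1 := habc
  have d1 := habd
  have b2 : b ∉ ℓac := fun h => c1 (e hab h2 h1 a2 h a1 b1 ▸ c2)
  have d2 := hacd
  have b3 : b ∉ ℓad := fun h => d1 (e hab h3 h1 a3 h a1 b1 ▸ d3)
  have c3 : c ∉ ℓad := fun h => d2 (e hac h3 h2 a3 h a2 c2 ▸ d3)
  have a4 : a ∉ ℓbc := fun h => c1 (e hab h4 h1 h b4 a1 b1 ▸ c4)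
  have d4 := hbcd
  have a5 : a ∉ ℓbd := fun h => d1 (e hab h5 h1 h b5 a1 b1 ▸ d5)
  have c5 : c ∉ ℓbd := fun h => d4 (e hbc h5 h4 b5 h b4 c4 ▸ d5)
  have a6 : a ∉ ℓcd := fun h => d2 (e hac h6 h2 h c6 a2 c2 ▸ d6)
  have b6 : b ∉ ℓcd := fun h => d4 (e hbc h6 h4 h c6 b4 c4 ▸ d6)
  have h : ∀ x, (if ¬ Pl.Collinear {a, b, x} ∧ ¬ Pl.Collinear {a, c, x} ∧
      ¬ Pl.Collinear {a, d, x} ∧ ¬ Pl.Collinear {b, c, x} ∧ ¬ Pl.Collinear {b, d, x} ∧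
      ¬ Pl.Collinear {c, d, x} then 1 else 0 : ℤ) =
      1 - (if x ∈ ℓab then 1 else 0) - (if x ∈ ℓac then 1 else 0) - (if x ∈ ℓad then 1 else 0) -
      (if x ∈ ℓbc then 1 else 0) - (if x ∈ ℓbd then 1 else 0) - (if x ∈ ℓcd then 1 else 0) +
      (if x = a then 2 else 0) + (if x = b then 2 else 0) + (if x = c then 2 else 0) +
      (if x = d then 2 else 0) +
      (if x ∈ ℓab ∧ x ∈ ℓcd then 1 else 0) + (if x ∈ ℓac ∧ x ∈ ℓbd then 1 else 0) +
      (if x ∈ ℓad ∧ x ∈ ℓbc then 1 else 0) := by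
    intro x
    rw [Pl.collinear_iff_mem hab h1 a1 b1, Pl.collinear_iff_mem hac h2 a2 c2,
      Pl.collinear_iff_mem had h3 a3 d3, Pl.collinear_iff_mem hbc h4 b4 c4,
      Pl.collinear_iff_mem hbd h5 b5 d5, Pl.collinear_iff_mem hcd h6 c6 d6]
    have e' : ∀ {p : Pl.Point} {ℓ m : Set Pl.Point} (r : Pl.Point), ℓ ∈ Pl.L → m ∈ Pl.L →
        p ∈ ℓ → p ∈ m → r ∈ ℓ → r ∉ m → x ≠ p → x ∈ ℓ → x ∉ m :=
      fun r hℓ hm hpℓ hpm hr hr' hx hxℓ hxm => hr' (e hx hℓ hm hxℓ hpℓ hxm hpm ▸ hr)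
    by_cases xa : x = a
    · subst xa; simp [*]
    by_cases xb : x = b
    · subst xb; simp [*]
    by_cases xc : x = c
    · subst xc; simp [*]
    by_cases xd : x = d
    · subst xd; simp [*]
    have n12 := e' b h1 h2 a1 a2 b1 b2 xa
    have n13 := e' b h1 h3 a1 a3 b1 b3 xa
    have n23 := e' c h2 h3 a2 a3 c2 c3 xa
    have n14 := e' a h1 h4 b1 b4 a1 a4 xb
    have n15 := e' a h1 h5 b1 b5 a1 a5 xb
    have n45 := e' c h4 h5 b4 b5 c4 c5 xb
    have n24 := e' a h2 h4 c2 c4 a2 a4 xc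
    have n26 := e' a h2 h6 c2 c6 a2 a6 xc
    have n46 := e' b h4 h6 c4 c6 b4 b6 xc
    have n35 := e' a h3 h5 d3 d5 a3 a5 xd
    have n36 := e' a h3 h6 d3 d6 a3 a6 xd
    have n56 := e' b h5 h6 d5 d6 b5 b6 xd
    clear e e'
    by_cases x1 : x ∈ ℓab <;> by_cases x2 : x ∈ ℓac <;> by_cases x3 : x ∈ ℓad <;>
      by_cases x4 : x ∈ ℓbc <;> by_cases x5 : x ∈ ℓbd <;> by_cases x6 : x ∈ ℓcd <;> simp_all
  simp only [h, Finset.sum_sub_distrib, Finset.sum_add_distrib, Pl.sum_mem_line h1,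
    Pl.sum_mem_line h2, Pl.sum_mem_line h3, Pl.sum_mem_line h4, Pl.sum_mem_line h5,
    Pl.sum_mem_line h6, Pl.sum_mem_inter h1 h6 (fun h => a6 (h ▸ a1)),
    Pl.sum_mem_inter h2 h5 (fun h => a5 (h ▸ a2)), Pl.sum_mem_inter h3 h4 (fun h => a4 (h ▸ a3))]
  simp [Pl.card_point]
  ring

theorem five_arc_iff (p : Fin 5 → Pl.Point) :
    (Function.Injective p ∧
      ∀ i j k : Fin 5, i ≠ j → i ≠ k → j ≠ k → ¬ Pl.Collinear {p i, p j, p k}) ↔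
    ((p 0 ≠ p 1 ∧ ¬ Pl.Collinear {p 0, p 1, p 2}) ∧
      ¬ Pl.Collinear {p 0, p 1, p 3} ∧ ¬ Pl.Collinear {p 0, p 2, p 3} ∧
        ¬ Pl.Collinear {p 1, p 2, p 3}) ∧
      ¬ Pl.Collinear {p 0, p 1, p 4} ∧ ¬ Pl.Collinear {p 0, p 2, p 4} ∧
        ¬ Pl.Collinear {p 0, p 3, p 4} ∧ ¬ Pl.Collinear {p 1, p 2, p 4} ∧
        ¬ Pl.Collinear {p 1, p 3, p 4} ∧ ¬ Pl.Collinear {p 2, p 3, p 4} := by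
  constructor
  · rintro ⟨hp, h⟩
    refine ⟨⟨⟨hp.ne (by decide), ?_⟩, ?_, ?_, ?_⟩, ?_, ?_, ?_, ?_, ?_, ?_⟩ <;>
      (apply h <;> decide)
  · intro h
    have hT : ∀ i j k : Fin 5, i < j → j < k → ¬ Pl.Collinear {p i, p j, p k} := by
      intro i j k hij hjk
      fin_cases i <;> fin_cases j <;> fin_cases k <;> simp at hij hjk <;> tauto
    have hN : ∀ i j k : Fin 5, i ≠ j → i ≠ k → j ≠ k → ¬ Pl.Collinear {p i, p j, p k} := by
      intro i j k hij hik hjk hc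
      have r := @Pl.collinear_rotate
      have s := @Pl.collinear_swap
      rcases lt_or_gt_of_ne hij with h1 | h1 <;> rcases lt_or_gt_of_ne hik with h2 | h2 <;>
        rcases lt_or_gt_of_ne hjk with h3 | h3
      · exact hT _ _ _ h1 h3 hc
      · exact hT _ _ _ h2 h3 (s (r (r hc)))
      · omega
      · exact hT _ _ _ h2 h1 (r (r hc))
      · exact hT _ _ _ h1 h2 (s hc)
      · omega
      · exact hT _ _ _ h3 h2 (r hc)
      · exact hT _ _ _ h3 h1 (s (r hc))
    refine ⟨fun i j hij => ?_, hN⟩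
    by_contra hne
    obtain ⟨k, hik, hjk⟩ : ∃ k : Fin 5, i ≠ k ∧ j ≠ k := by
      clear hij hne; revert i j; decide
    exact (Pl.ne_of_not_collinear (hN i j k hne hik hjk)).1 hij

/-- Ordered quintuples as iterated pairs. -/
def quintupleEquiv (α : Type*) : (Fin 5 → α) ≃ α × α × α × α × α where
  toFun p := (p 0, p 1, p 2, p 3, p 4)
  invFun t := ![t.1, t.2.1, t.2.2.1, t.2.2.2.1, t.2.2.2.2]
  left_inv p := by ext i; fin_cases i <;> rfl
  right_inv _ := rfl

end ProjPlane

theorem sum_ite_and_const {α : Type*} [Fintype α] {P : Prop} [Decidable P]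
    {Q : α → Prop} [DecidablePred Q] {k : ℤ} (m : ℤ)
    (h : P → ∑ x, (if Q x then 1 else 0) = k) :
    ∑ x, (if P ∧ Q x then m else 0) = if P then k * m else 0 := by
  by_cases hP : P
  · simp only [hP, true_and, if_true, ← h hP, Finset.sum_mul, ite_mul, one_mul, zero_mul]
  · simp [hP]

/-- For every finite projective plane of order `q`, the number of ordered
5-arcs is `(q² + q + 1)(q² + q)q²(q-1)²(q² - 5q + 6)`. -/
theorem count_five_arcs (q : ℕ) (Pl : ProjPlane q) :
    (Pl.nArcs 5 : ℤ) =
      ((q : ℤ) ^ 2 + q + 1) * ((q : ℤ) ^ 2 + q) * (q : ℤ) ^ 2 * ((q : ℤ) - 1) ^ 2 *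
        ((q : ℤ) ^ 2 - 5 * q + 6) := by
  rw [ProjPlane.nArcs, Nat.card_congr ((ProjPlane.quintupleEquiv Pl.Point).subtypeEquiv
    (q := fun ⟨a, b, c, d, e⟩ => ((a ≠ b ∧ ¬ Pl.Collinear {a, b, c}) ∧
      ¬ Pl.Collinear {a, b, d} ∧ ¬ Pl.Collinear {a, c, d} ∧ ¬ Pl.Collinear {b, c, d}) ∧
      ¬ Pl.Collinear {a, b, e} ∧ ¬ Pl.Collinear {a, c, e} ∧ ¬ Pl.Collinear {a, d, e} ∧
      ¬ Pl.Collinear {b, c, e} ∧ ¬ Pl.Collinear {b, d, e} ∧ ¬ Pl.Collinear {c, d, e})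
    Pl.five_arc_iff), Nat.card_eq_fintype_card, Fintype.card_subtype, ← Finset.sum_boole]
  simp only [Fintype.sum_prod_type]
  have h5 := fun a b c d => sum_ite_and_const 1
    (fun h : (a ≠ b ∧ ¬ Pl.Collinear {a, b, c}) ∧ ¬ Pl.Collinear {a, b, d} ∧
      ¬ Pl.Collinear {a, c, d} ∧ ¬ Pl.Collinear {b, c, d} =>
      Pl.sum_extend_four_arc h.1.2 h.2.1 h.2.2.1 h.2.2.2)
  have h4 := fun a b c m => sum_ite_and_const m
    (fun h : a ≠ b ∧ ¬ Pl.Collinear {a, b, c} => Pl.sum_extend_three_arc h.2)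
  have h3 := fun a b m => sum_ite_and_const m (fun h : a ≠ b => Pl.sum_not_collinear h)
  have h2 := fun a m => sum_ite_and_const (P := True) m (fun _ => Pl.sum_ne a)
  simp only [true_and, if_true] at h2
  simp only [h5, h4, h3, h2, Finset.sum_const, Finset.card_univ, nsmul_eq_mul, Pl.card_point]
  ring
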